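/- Let I = [s,t] ⊆ ℝ/ℤ be a generalized dyadic interval. Then: (i) there exists a point x in the open arc (s,t) colored red such that both [s,x] and [x,t] are generalized dyadic intervals; (ii) if at least one of s, t is colored red, there exists a point x in the open arc (s,t) colored blue such that both [s,x] and [x,t] are generalized dyadic intervals. -/

import Mathlib

noncomputable section

open Set

/-- The circle `ℝ/ℤ`. -/
abbrev 𝕊 : Type := AddCircle (1 : ℝ)

/-- The natural projection from `ℝ` to the circle `ℝ/ℤ`. -/
def tc (x : ℝ) : 𝕊 := (x : 𝕊)

/-- The closed arc on the circle from `a` to `b`, traversed in the positive direction;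
arcs are parametrized by real lifts `a ≤ b ≤ a + 1` of their endpoints. -/
def cArc (a b : ℝ) : Set 𝕊 := tc '' Set.Icc a b

/-- The open arc on the circle from `a` to `b` (the interior of `cArc a b`). -/
def oArc (a b : ℝ) : Set 𝕊 := tc '' Set.Ioo a b

/-- The multiplication-by-`d` map `σ_d : ℝ/ℤ → ℝ/ℤ`, `σ_d t = d·t`. -/
def sigmaC (d : ℕ) (x : 𝕊) : 𝕊 := d • x

/-- The four model arcs `(0,1)`, `(0,2/3)`, `(1/3,2/3)`, `(1/3,1)` of generalized dyadic
intervals, given by the pairs of endpoints. -/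
def gdTypes : Set (ℝ × ℝ) :=
  {(0, 1), (0, 2/3), (1/3, 2/3), (1/3, 1)}

/-- The arc `[a,b]` is a generalized dyadic interval of type `J`: for some `m ≥ 0`, the map
`σ₂^m` restricts to a homeomorphism from the open arc `(a,b)` onto the open model arc `J`. -/
def IsGenDyadicWith (a b : ℝ) (J : ℝ × ℝ) : Prop :=
  a < b ∧ b ≤ a + 1 ∧ J ∈ gdTypes ∧
    ∃ m : ℕ, ∃ e : ↥(oArc a b) ≃ₜ ↥(oArc J.1 J.2),
      ∀ x : ↥(oArc a b), (e x : 𝕊) = (sigmaC 2)^[m] ↑x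

/-- The arc `[a,b]` is a generalized dyadic interval. -/
def IsGenDyadic (a b : ℝ) : Prop := ∃ J, IsGenDyadicWith a b J

/-- A point of the circle is colored red if some iterate of the doubling map sends it
to `0`. -/
def RedG (x : 𝕊) : Prop := ∃ k : ℕ, (sigmaC 2)^[k] x = 0

/-- A point of the circle is colored blue if some iterate of the doubling map sends it to
`1/3` or `2/3`. -/
def BlueG (x : 𝕊) : Prop :=
  ∃ k : ℕ, (sigmaC 2)^[k] x = tc (1/3) ∨ (sigmaC 2)^[k] x = tc (2/3)

theorem tc_eq_tc_iff {x y : ℝ} : tc x = tc y ↔ ∃ n : ℤ, y = x + n := by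
  rw [tc, tc, eq_comm, ← sub_eq_zero, ← AddCircle.coe_sub, AddCircle.coe_eq_zero_iff]
  simp only [zsmul_eq_mul, mul_one, eq_comm (b := y - x), sub_eq_iff_eq_add']

theorem sigmaC_two_iterate (m : ℕ) (x : 𝕊) : (sigmaC 2)^[m] x = 2 ^ m • x := by
  induction m with
  | zero => simp
  | succ m ih => rw [Function.iterate_succ_apply', ih, sigmaC, smul_smul, pow_succ']

theorem pow_two_nsmul_tc (m : ℕ) (x : ℝ) : 2 ^ m • tc x = tc (2 ^ m * x) := by
  simp [tc, ← AddCircle.coe_nsmul]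

theorem isOpenMap_tc : IsOpenMap tc := QuotientAddGroup.isOpenMap_coe

theorem continuous_tc : Continuous tc := AddCircle.continuous_mk' 1

theorem tc_surjective : Function.Surjective tc := QuotientAddGroup.mk_surjective

theorem isOpen_oArc (a b : ℝ) : IsOpen (oArc a b) := isOpenMap_tc _ isOpen_Ioo

theorem isOpenMap_pow_two_nsmul (m : ℕ) : IsOpenMap fun x : 𝕊 => 2 ^ m • x := by
  refine IsOpenMap.of_comp continuous_tc tc_surjective ?_
  have h : (fun x : 𝕊 => 2 ^ m • x) ∘ tc = tc ∘ fun x => 2 ^ m * x :=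
    funext fun x => pow_two_nsmul_tc m x
  rw [h]
  exact isOpenMap_tc.comp (Homeomorph.mulLeft₀ ((2 : ℝ) ^ m) (by positivity)).isOpenMap

theorem tc_left_notMem_oArc {a b : ℝ} (h : b ≤ a + 1) : tc a ∉ oArc a b := by
  rintro ⟨x, ⟨hax, hxb⟩, hx⟩
  obtain ⟨n, rfl⟩ := tc_eq_tc_iff.1 hx.symm
  have h0 : (0 : ℝ) < n := by linarith
  have h1 : (n : ℝ) < 1 := by linarith
  norm_cast at h0 h1
  omega

theorem tc_right_notMem_oArc {a b : ℝ} (h : b ≤ a + 1) : tc b ∉ oArc a b := by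
  rintro ⟨x, ⟨hax, hxb⟩, hx⟩
  obtain ⟨n, rfl⟩ := tc_eq_tc_iff.1 hx.symm
  have h0 : (n : ℝ) < 0 := by linarith
  have h1 : (-1 : ℝ) < n := by linarith
  norm_cast at h0 h1
  omega

theorem tc_add_intCast (x : ℝ) (n : ℤ) : tc (x + n) = tc x :=
  (tc_eq_tc_iff.2 ⟨n, rfl⟩).symm

/-- Two open arcs of length at most one that coincide have the same lifts up to an integer. -/
theorem exists_int_of_oArc_eq {a b c d : ℝ} (hab : a < b) (hb : b ≤ a + 1) (hd : d ≤ c + 1)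
    (h : oArc a b = oArc c d) : ∃ n : ℤ, a = c + n ∧ b = d + n := by
  obtain ⟨s, has, hsb⟩ := exists_between hab
  obtain ⟨t, ⟨hct, htd⟩, hts⟩ : tc s ∈ oArc c d := h ▸ ⟨s, ⟨has, hsb⟩, rfl⟩
  obtain ⟨n, rfl⟩ := tc_eq_tc_iff.1 hts
  have mem {x : ℝ} (h₁ : c + n < x) (h₂ : x < d + n) : tc x ∈ oArc a b := by
    rw [h]
    refine ⟨x - n, ⟨by linarith, by linarith⟩, ?_⟩
    rw [← tc_add_intCast (x - n) n, sub_add_cancel]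
  refine ⟨n, le_antisymm ?_ ?_, le_antisymm ?_ ?_⟩ <;> by_contra! hlt
  · exact tc_left_notMem_oArc hb (mem hlt (by linarith))
  · exact tc_left_notMem_oArc hd (h ▸ ⟨c + n, ⟨hlt, by linarith⟩, tc_add_intCast c n⟩)
  · exact tc_right_notMem_oArc hd (h ▸ ⟨d + n, ⟨by linarith, hlt⟩, tc_add_intCast d n⟩)
  · exact tc_right_notMem_oArc hb (mem (by linarith) hlt)

theorem image_oArc (m : ℕ) (a b : ℝ) :
    (fun x : 𝕊 => 2 ^ m • x) '' oArc a b = oArc (2 ^ m * a) (2 ^ m * b) := by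
  have hpos : (0 : ℝ) < 2 ^ m := by positivity
  rw [oArc, oArc, ← image_mul_left_Ioo hpos, image_image, image_image]
  exact image_congr fun x _ => pow_two_nsmul_tc m x

theorem injOn_oArc {m : ℕ} {a b : ℝ} (h : 2 ^ m * b ≤ 2 ^ m * a + 1) :
    InjOn (fun x : 𝕊 => 2 ^ m • x) (oArc a b) := by
  have hpos : (0 : ℝ) < 2 ^ m := by positivity
  rintro _ ⟨s, ⟨has, hsb⟩, rfl⟩ _ ⟨t, ⟨hat, htb⟩, rfl⟩ hst
  simp only [pow_two_nsmul_tc] at hst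
  obtain ⟨n, hn⟩ := tc_eq_tc_iff.1 hst
  have h₁ := mul_lt_mul_of_pos_left has hpos
  have h₂ := mul_lt_mul_of_pos_left hsb hpos
  have h₃ := mul_lt_mul_of_pos_left hat hpos
  have h₄ := mul_lt_mul_of_pos_left htb hpos
  have h₅ : (n : ℝ) < 1 := by linarith
  have h₆ : (-1 : ℝ) < n := by linarith
  norm_cast at h₅ h₆
  obtain rfl : n = 0 := by omega
  rw [Int.cast_zero, add_zero] at hn
  rw [mul_left_cancel₀ hpos.ne' hn]

theorem length_le_of_injOn {m : ℕ} {a b : ℝ} (hb : b ≤ a + 1)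
    (h : InjOn (fun x : 𝕊 => 2 ^ m • x) (oArc a b)) : 2 ^ m * b ≤ 2 ^ m * a + 1 := by
  have hpos : (0 : ℝ) < 2 ^ m := by positivity
  by_contra! hlt
  have hgap : a < b - 1 / 2 ^ m := by
    rw [lt_sub_iff_add_lt, ← mul_lt_mul_iff_right₀ hpos]
    field_simp
    linarith
  obtain ⟨s, has, hsb⟩ := exists_between hgap
  have hinv : (0 : ℝ) < 1 / 2 ^ m := by positivity
  have heq : tc s = tc (s + 1 / 2 ^ m) := by
    refine h ⟨s, ⟨has, by linarith⟩, rfl⟩ ⟨_, ⟨by linarith, by linarith⟩, rfl⟩ ?_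
    simp only [pow_two_nsmul_tc]
    refine tc_eq_tc_iff.2 ⟨1, ?_⟩
    field_simp
    simp
  refine tc_left_notMem_oArc (b := b) (by linarith : b ≤ s + 1) ?_
  rw [heq]
  exact ⟨_, ⟨by linarith, by linarith⟩, rfl⟩

theorem gdTypes_bounds {J : ℝ × ℝ} (hJ : J ∈ gdTypes) : J.1 < J.2 ∧ J.2 ≤ J.1 + 1 := by
  simp only [gdTypes, mem_insert_iff, mem_singleton_iff] at hJ
  rcases hJ with rfl | rfl | rfl | rfl <;> norm_num

/-- Generalized dyadic intervals are those whose real lifts are carried to a translate of a model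
arc by a power of two. -/
theorem isGenDyadic_iff {a b : ℝ} : IsGenDyadic a b ↔
    ∃ J ∈ gdTypes, ∃ (m : ℕ) (n : ℤ), 2 ^ m * a = J.1 + n ∧ 2 ^ m * b = J.2 + n := by
  constructor
  · rintro ⟨J, hab, hb, hJ, m, e, he⟩
    have hpos : (0 : ℝ) < 2 ^ m := by positivity
    simp only [sigmaC_two_iterate] at he
    have hinj : InjOn (fun x : 𝕊 => 2 ^ m • x) (oArc a b) := fun x hx y hy hxy => by
      have hxy' : e ⟨x, hx⟩ = e ⟨y, hy⟩ := Subtype.ext (by rw [he, he]; exact hxy)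
      exact congrArg Subtype.val (e.injective hxy')
    have himg : oArc (2 ^ m * a) (2 ^ m * b) = oArc J.1 J.2 := by
      rw [← image_oArc]
      ext y
      constructor
      · rintro ⟨x, hx, rfl⟩
        have := (e ⟨x, hx⟩).2
        rwa [he] at this
      · intro hy
        refine ⟨e.symm ⟨y, hy⟩, (e.symm ⟨y, hy⟩).2, ?_⟩
        simp only [← he, Homeomorph.apply_symm_apply]
    obtain ⟨n, hn⟩ := exists_int_of_oArc_eq (mul_lt_mul_of_pos_left hab hpos)
      (length_le_of_injOn hb hinj) (gdTypes_bounds hJ).2 himg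
    exact ⟨J, hJ, m, n, hn⟩
  · rintro ⟨J, hJ, m, n, ha, hb⟩
    have hpos : (0 : ℝ) < 2 ^ m := by positivity
    have hone : (1 : ℝ) ≤ 2 ^ m := one_le_pow₀ one_le_two
    obtain ⟨hJ₁, hJ₂⟩ := gdTypes_bounds hJ
    have hab : a < b := lt_of_mul_lt_mul_left (by linarith) hpos.le
    refine ⟨J, hab, ?_, hJ, m, ?_⟩
    · nlinarith
    have himg : (fun x : 𝕊 => 2 ^ m • x) '' oArc a b = oArc J.1 J.2 := by
      rw [image_oArc, ha, hb, oArc, oArc, ← image_add_const_Ioo, image_image]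
      exact image_congr fun x _ => tc_add_intCast x n
    have hmaps : MapsTo (fun x : 𝕊 => 2 ^ m • x) (oArc a b) (oArc J.1 J.2) :=
      himg ▸ mapsTo_image _ _
    have hhomeo : IsHomeomorph hmaps.restrict := by
      refine ⟨?_, ?_, ?_, ?_⟩
      · exact (continuous_const_smul (2 ^ m : ℕ)).restrict hmaps
      · exact ((isOpenMap_pow_two_nsmul m).domRestrict (isOpen_oArc a b)).subtype_mk _
      · exact (injOn_oArc (by linarith)).injective.codRestrict _
      · rw [MapsTo.restrict_surjective_iff]
        exact himg.symm.subset
    exact ⟨hhomeo.homeomorph, fun x => by rw [sigmaC_two_iterate]; rfl⟩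

theorem isGenDyadic_of_model {a b c d : ℝ} {m : ℕ} {n : ℤ} (ha : 2 ^ m * a = c + n)
    (hb : 2 ^ m * b = d + n) (h : IsGenDyadic c d) : IsGenDyadic a b := by
  obtain ⟨J, hJ, j, k, hc, hd⟩ := isGenDyadic_iff.1 h
  refine isGenDyadic_iff.2 ⟨J, hJ, j + m, k + 2 ^ j * n, ?_, ?_⟩
  · rw [pow_add, mul_assoc, ha, mul_add, hc]
    push_cast
    ring
  · rw [pow_add, mul_assoc, hb, mul_add, hd]
    push_cast
    ring

theorem isGenDyadic_of_mem {a b : ℝ} (h : (a, b) ∈ gdTypes) : IsGenDyadic a b :=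
  isGenDyadic_iff.2 ⟨_, h, 0, 0, by simp, by simp⟩

theorem isGenDyadic_zero_one : IsGenDyadic 0 1 := isGenDyadic_of_mem (by simp [gdTypes])

theorem isGenDyadic_zero_two_thirds : IsGenDyadic 0 (2 / 3) :=
  isGenDyadic_of_mem (by simp [gdTypes])

theorem isGenDyadic_third_two_thirds : IsGenDyadic (1 / 3) (2 / 3) :=
  isGenDyadic_of_mem (by simp [gdTypes])

theorem isGenDyadic_third_one : IsGenDyadic (1 / 3) 1 :=
  isGenDyadic_of_mem (by simp [gdTypes])

theorem isGenDyadic_zero_half : IsGenDyadic 0 (1 / 2) :=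
  isGenDyadic_of_model (m := 1) (n := 0) (by norm_num) (by norm_num) isGenDyadic_zero_one

theorem isGenDyadic_half_one : IsGenDyadic (1 / 2) 1 :=
  isGenDyadic_of_model (m := 1) (n := 1) (by norm_num) (by norm_num) isGenDyadic_zero_one

theorem isGenDyadic_zero_third : IsGenDyadic 0 (1 / 3) :=
  isGenDyadic_of_model (m := 1) (n := 0) (by norm_num) (by norm_num) isGenDyadic_zero_two_thirds

theorem isGenDyadic_two_thirds_one : IsGenDyadic (2 / 3) 1 :=
  isGenDyadic_of_model (m := 1) (n := 1) (by norm_num) (by norm_num) isGenDyadic_third_one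

theorem isGenDyadic_half_two_thirds : IsGenDyadic (1 / 2) (2 / 3) :=
  isGenDyadic_of_model (m := 1) (n := 1) (by norm_num) (by norm_num) isGenDyadic_zero_third

theorem isGenDyadic_third_half : IsGenDyadic (1 / 3) (1 / 2) :=
  isGenDyadic_of_model (m := 1) (n := 0) (by norm_num) (by norm_num) isGenDyadic_two_thirds_one

theorem redG_tc_iff {x : ℝ} : RedG (tc x) ↔ ∃ (k : ℕ) (n : ℤ), 2 ^ k * x = n := by
  have h0 : (0 : 𝕊) = tc 0 := rfl
  simp only [RedG, sigmaC_two_iterate, pow_two_nsmul_tc, h0]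
  refine exists_congr fun k => ?_
  rw [eq_comm, tc_eq_tc_iff]
  simp

theorem redG_of_eq_half_add {x : ℝ} {m : ℕ} {n : ℤ} (h : 2 ^ m * x = 1 / 2 + n) :
    RedG (tc x) := by
  refine redG_tc_iff.2 ⟨m + 1, 1 + 2 * n, ?_⟩
  rw [pow_succ', mul_assoc, h]
  push_cast
  ring

theorem blueG_of_eq_add {x c : ℝ} {m : ℕ} {n : ℤ} (h : 2 ^ m * x = c + n)
    (hc : c = 1 / 3 ∨ c = 2 / 3) : BlueG (tc x) := by
  refine ⟨m, ?_⟩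
  rw [sigmaC_two_iterate, pow_two_nsmul_tc, h, tc_add_intCast]
  exact hc.imp (congrArg tc) (congrArg tc)

/-- A point with an iterate at `1/3` or `2/3` is never red. -/
theorem not_redG_of_three_mul_eq {x : ℝ} {m : ℕ} {p : ℤ} (hp : ¬ (3 : ℤ) ∣ p)
    (h : 3 * (2 ^ m * x) = p) : ¬ RedG (tc x) := by
  rw [redG_tc_iff]
  rintro ⟨k, n, hk⟩
  have hreal : (2 : ℝ) ^ k * p = 3 * (2 ^ m * n) := by
    rw [← h, ← hk]
    ring
  have hint : (2 : ℤ) ^ k * p = 3 * (2 ^ m * n) := by exact_mod_cast hreal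
  have hprime : Prime (3 : ℤ) := Int.prime_three
  rcases hprime.dvd_or_dvd (Dvd.intro _ hint.symm) with h2 | h2
  · have := hprime.dvd_of_dvd_pow h2
    omega
  · exact hp h2

/-- A splitting point of a model arc pulls back to a splitting point of `[a, b]`. -/
theorem exists_split {a b c d y : ℝ} {m : ℕ} {n : ℤ} (ha : 2 ^ m * a = c + n)
    (hb : 2 ^ m * b = d + n) (hcy : IsGenDyadic c y) (hyd : IsGenDyadic y d) :
    ∃ x ∈ Ioo a b, 2 ^ m * x = y + n ∧ IsGenDyadic a x ∧ IsGenDyadic x b := by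
  have hpos : (0 : ℝ) < 2 ^ m := by positivity
  have hx : 2 ^ m * ((y + n) / 2 ^ m) = y + n := mul_div_cancel₀ _ hpos.ne'
  have hax := isGenDyadic_of_model ha hx hcy
  have hxb := isGenDyadic_of_model hx hb hyd
  have ⟨_, h₁, _⟩ := hax
  have ⟨_, h₂, _⟩ := hxb
  exact ⟨_, ⟨h₁, h₂⟩, hx, hax, hxb⟩

/-- Let `I = [s,t]` be a generalized dyadic interval. (i) There is a red point `x` in the
open arc `(s,t)` such that `[s,x]` and `[x,t]` are generalized dyadic intervals. (ii) If at
least one of `s, t` is red, there is a blue point `x` in `(s,t)` such that `[s,x]` and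
`[x,t]` are generalized dyadic intervals. -/
theorem genDyadic_decomposition (a b : ℝ) (h : IsGenDyadic a b) :
    (∃ x ∈ Set.Ioo a b, RedG (tc x) ∧ IsGenDyadic a x ∧ IsGenDyadic x b) ∧
    ((RedG (tc a) ∨ RedG (tc b)) →
      ∃ x ∈ Set.Ioo a b, BlueG (tc x) ∧ IsGenDyadic a x ∧ IsGenDyadic x b) := by
  obtain ⟨J, hJ, m, n, ha, hb⟩ := isGenDyadic_iff.1 h
  have red (h₁ : IsGenDyadic J.1 (1 / 2)) (h₂ : IsGenDyadic (1 / 2) J.2) :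
      ∃ x ∈ Set.Ioo a b, RedG (tc x) ∧ IsGenDyadic a x ∧ IsGenDyadic x b := by
    obtain ⟨x, hx, hxy, hs⟩ := exists_split ha hb h₁ h₂
    exact ⟨x, hx, redG_of_eq_half_add hxy, hs⟩
  have blue {y : ℝ} (hy : y = 1 / 3 ∨ y = 2 / 3) (h₁ : IsGenDyadic J.1 y)
      (h₂ : IsGenDyadic y J.2) :
      ∃ x ∈ Set.Ioo a b, BlueG (tc x) ∧ IsGenDyadic a x ∧ IsGenDyadic x b := by
    obtain ⟨x, hx, hxy, hs⟩ := exists_split ha hb h₁ h₂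
    exact ⟨x, hx, blueG_of_eq_add hxy hy, hs⟩
  simp only [gdTypes, mem_insert_iff, mem_singleton_iff] at hJ
  rcases hJ with rfl | rfl | rfl | rfl
  · exact ⟨red isGenDyadic_zero_half isGenDyadic_half_one,
      fun _ => blue (.inl rfl) isGenDyadic_zero_third isGenDyadic_third_one⟩
  · exact ⟨red isGenDyadic_zero_half isGenDyadic_half_two_thirds,
      fun _ => blue (.inl rfl) isGenDyadic_zero_third isGenDyadic_third_two_thirds⟩
  · refine ⟨red isGenDyadic_third_half isGenDyadic_half_two_thirds, fun hred => ?_⟩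
    have hna : ¬ RedG (tc a) := not_redG_of_three_mul_eq (m := m) (p := 1 + 3 * n) (by omega) (by
      rw [ha]
      push_cast
      ring)
    have hnb : ¬ RedG (tc b) := not_redG_of_three_mul_eq (m := m) (p := 2 + 3 * n) (by omega) (by
      rw [hb]
      push_cast
      ring)
    exact absurd hred (not_or.2 ⟨hna, hnb⟩)
  · exact ⟨red isGenDyadic_third_half isGenDyadic_half_one,
      fun _ => blue (.inr rfl) isGenDyadic_third_two_thirds isGenDyadic_two_thirds_one⟩
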